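/- Fix an integer d ≥ 1 and let j_d(k) = #{(k_1,…,k_d) ∈ ℤ^d : k_1² + ⋯ + k_d² = k}. With A(x) = (d/2)|log(1-x)| + ((d-2)/2)·log|log(1-x)| + (d/2)·log(d/2) + log(π^{d/2}/Γ(d/2+1)) and M(x,t) = ⌊(A(x)+t)/|log x|⌋, for every fixed real t one has Σ_{k > M(x,t)} j_d(k)·x^k → e^{-t} as x → 1⁻. -/

import Mathlib

open Filter Topology
open MeasureTheory

/-- The half-open unit cube of `ℝ^d` with lower corner the lattice point `v`. -/
def unitCube {d : ℕ} (v : Fin d → ℤ) : Set (EuclideanSpace ℝ (Fin d)) :=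
  {y | ∀ i, ⌊y i⌋ = v i}

lemma unitCube_eq_preimage {d : ℕ} (v : Fin d → ℤ) :
    unitCube v = (WithLp.ofLp : EuclideanSpace ℝ (Fin d) → Fin d → ℝ) ⁻¹'
      (Set.univ.pi fun i => Set.Ico (v i : ℝ) (v i + 1)) := by
  ext y
  simp [unitCube, Int.floor_eq_iff]

lemma measurableSet_unitCube {d : ℕ} (v : Fin d → ℤ) : MeasurableSet (unitCube v) := by
  rw [unitCube_eq_preimage]
  exact (PiLp.volume_preserving_ofLp (Fin d)).measurable
    (MeasurableSet.univ_pi fun i => measurableSet_Ico)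

lemma volume_unitCube {d : ℕ} (v : Fin d → ℤ) : volume (unitCube v) = 1 := by
  rw [unitCube_eq_preimage, (PiLp.volume_preserving_ofLp (Fin d)).measure_preimage
    (MeasurableSet.univ_pi fun i => measurableSet_Ico).nullMeasurableSet, Real.volume_pi_Ico]
  simp

lemma volume_biUnion_unitCube {d : ℕ} (S : Finset (Fin d → ℤ)) :
    volume (⋃ v ∈ S, unitCube v) = S.card := by
  rw [measure_biUnion_finset]
  · simp [volume_unitCube]
  · intro v _ w _ hvw
    refine Set.disjoint_left.2 fun y hv hw => hvw ?_
    funext i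
    rw [← hv i, hw i]
  · exact fun v _ => measurableSet_unitCube v

lemma norm_sub_le_of_mem_unitCube {d : ℕ} {v : Fin d → ℤ} {y : EuclideanSpace ℝ (Fin d)}
    (hy : y ∈ unitCube v) :
    ‖y - WithLp.toLp 2 (fun i => (v i : ℝ))‖ ≤ √d := by
  rw [EuclideanSpace.norm_eq]
  refine Real.sqrt_le_sqrt ?_
  calc ∑ i, ‖(y - WithLp.toLp 2 (fun i => (v i : ℝ))).ofLp i‖ ^ 2 ≤ ∑ _i : Fin d, (1 : ℝ) := by
        refine Finset.sum_le_sum fun i _ => ?_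
        have h1 := Int.floor_le (y i)
        have h2 := Int.lt_floor_add_one (y i)
        rw [hy i] at h1 h2
        simp only [PiLp.sub_apply, Real.norm_eq_abs, sq_abs]
        nlinarith
    _ = d := by simp

/-- The volume of the unit ball of `ℝ^d`. -/
noncomputable def ballVolume (d : ℕ) : ℝ :=
  Real.pi ^ ((d : ℝ) / 2) / Real.Gamma ((d : ℝ) / 2 + 1)

lemma ballVolume_pos (d : ℕ) : 0 < ballVolume d :=
  div_pos (Real.rpow_pos_of_pos Real.pi_pos _) (Real.Gamma_pos_of_pos (by positivity))

lemma volume_closedBall_eq_ballVolume {d : ℕ} (hd : 1 ≤ d) {r : ℝ} (hr : 0 ≤ r) :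
    volume (Metric.closedBall (0 : EuclideanSpace ℝ (Fin d)) r)
      = ENNReal.ofReal (ballVolume d * r ^ d) := by
  have : Nonempty (Fin d) := ⟨⟨0, hd⟩⟩
  have h : √Real.pi ^ d = Real.pi ^ ((d : ℝ) / 2) := by
    rw [Real.sqrt_eq_rpow, ← Real.rpow_natCast, ← Real.rpow_mul Real.pi_pos.le]
    congr 1
    ring
  rw [EuclideanSpace.volume_closedBall, Fintype.card_fin, h, ← ENNReal.ofReal_pow hr,
    ← ENNReal.ofReal_mul (by positivity), mul_comm, ballVolume]

lemma norm_toLp_intCast_le_iff {d : ℕ} (v : Fin d → ℤ) {r : ℝ} (hr : 0 ≤ r) :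
    ‖(WithLp.toLp 2 (fun i => (v i : ℝ)) : EuclideanSpace ℝ (Fin d))‖ ≤ r
      ↔ ∑ i, (v i : ℝ) ^ 2 ≤ r ^ 2 := by
  rw [EuclideanSpace.norm_eq, Real.sqrt_le_left hr]
  simp

lemma card_le_ballVolume_mul {d : ℕ} (hd : 1 ≤ d) {r : ℝ} (hr : 0 ≤ r) (S : Finset (Fin d → ℤ))
    (hS : ∀ v, v ∈ S ↔ ∑ i, (v i : ℝ) ^ 2 ≤ r ^ 2) :
    (S.card : ℝ) ≤ ballVolume d * (r + √d) ^ d := by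
  have hsub : (⋃ v ∈ S, unitCube v) ⊆ Metric.closedBall 0 (r + √d) := by
    intro y hy
    simp only [Set.mem_iUnion] at hy
    obtain ⟨v, hv, hy⟩ := hy
    rw [mem_closedBall_zero_iff]
    have h1 := norm_sub_le_of_mem_unitCube hy
    have h2 := (norm_toLp_intCast_le_iff v hr).2 ((hS v).1 hv)
    have h3 := norm_le_norm_add_norm_sub' y (WithLp.toLp 2 (fun i => (v i : ℝ)))
    linarith
  have h := measure_mono (μ := volume) hsub
  rw [volume_biUnion_unitCube, volume_closedBall_eq_ballVolume hd (by positivity),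
    ← ENNReal.ofReal_natCast] at h
  exact (ENNReal.ofReal_le_ofReal_iff
    (mul_nonneg (ballVolume_pos d).le (by positivity))).1 h

lemma ballVolume_mul_le_card {d : ℕ} (hd : 1 ≤ d) {r : ℝ} (hr : √d ≤ r) (S : Finset (Fin d → ℤ))
    (hS : ∀ v, v ∈ S ↔ ∑ i, (v i : ℝ) ^ 2 ≤ r ^ 2) :
    ballVolume d * (r - √d) ^ d ≤ (S.card : ℝ) := by
  have hsub : Metric.closedBall 0 (r - √d) ⊆ (⋃ v ∈ S, unitCube v) := by
    intro y hy
    have hmem : y ∈ unitCube (fun i => ⌊y i⌋) := fun i => rfl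
    rw [mem_closedBall_zero_iff] at hy
    simp only [Set.mem_iUnion]
    refine ⟨fun i => ⌊y i⌋, (hS _).2 ?_, hmem⟩
    rw [← norm_toLp_intCast_le_iff _ ((Real.sqrt_nonneg _).trans hr)]
    have h1 := norm_sub_le_of_mem_unitCube hmem
    have h3 := norm_le_norm_add_norm_sub y (WithLp.toLp 2 (fun i => (⌊y i⌋ : ℝ)))
    linarith
  have h := measure_mono (μ := volume) hsub
  rw [volume_biUnion_unitCube, volume_closedBall_eq_ballVolume hd (sub_nonneg.2 hr),
    ← ENNReal.ofReal_natCast] at h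
  exact (ENNReal.ofReal_le_ofReal_iff (Nat.cast_nonneg _)).1 h

lemma one_add_pow_le_one_add_two_pow_mul (n : ℕ) {z : ℝ} (h0 : 0 ≤ z) (h1 : z ≤ 1) :
    (1 + z) ^ n ≤ 1 + 2 ^ n * z := by
  suffices h : (1 + z) ^ n ≤ 1 + (2 ^ n - 1) * z by linarith
  induction n with
  | zero => simp
  | succ n ih =>
    have h2 : (1 : ℝ) ≤ 2 ^ n := one_le_pow₀ (by norm_num)
    calc (1 + z) ^ (n + 1) ≤ (1 + (2 ^ n - 1) * z) * (1 + z) := by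
          rw [pow_succ]
          gcongr
      _ ≤ 1 + (2 ^ (n + 1) - 1) * z := by
          rw [pow_succ]
          nlinarith [mul_nonneg (mul_nonneg (sub_nonneg.2 h2) h0) (sub_nonneg.2 h1)]

lemma abs_card_sub_ballVolume_mul_le {d : ℕ} (hd : 1 ≤ d) {r : ℝ} (hr : √d ≤ r)
    (S : Finset (Fin d → ℤ)) (hS : ∀ v, v ∈ S ↔ ∑ i, (v i : ℝ) ^ 2 ≤ r ^ 2) :
    |(S.card : ℝ) - ballVolume d * r ^ d| ≤ ballVolume d * 2 ^ d * √d * r ^ d / r := by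
  have hc : 0 < √(d : ℝ) := Real.sqrt_pos.2 (by exact_mod_cast hd)
  have hr0 : 0 < r := hc.trans_le hr
  have hV := ballVolume_pos d
  set z := √(d : ℝ) / r with hz
  have hz0 : 0 ≤ z := by positivity
  have hz1 : z ≤ 1 := (div_le_one hr0).2 hr
  have hcz : √(d : ℝ) = r * z := by rw [hz]; field_simp
  have hup := card_le_ballVolume_mul hd hr0.le S hS
  have hlo := ballVolume_mul_le_card hd hr S hS
  have e1 : (r + √d) ^ d = r ^ d * (1 + z) ^ d := by rw [hcz, ← mul_pow]; ring
  have e2 : (r - √d) ^ d = r ^ d * (1 - z) ^ d := by rw [hcz, ← mul_pow]; ring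
  have e3 : ballVolume d * 2 ^ d * √d * r ^ d / r = ballVolume d * r ^ d * (2 ^ d * z) := by
    rw [hz]; field_simp
  have b1 := one_add_pow_le_one_add_two_pow_mul d hz0 hz1
  have b2 : 1 - 2 ^ d * z ≤ (1 - z) ^ d := by
    have h := one_add_mul_le_pow (a := -z) (by linarith) d
    have h2 : (d : ℝ) ≤ 2 ^ d := by exact_mod_cast Nat.lt_two_pow_self.le
    have h3 := mul_le_mul_of_nonneg_right h2 hz0
    rw [← sub_eq_add_neg] at h
    linarith
  have hP : 0 ≤ ballVolume d * r ^ d := by positivity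
  rw [e1, ← mul_assoc] at hup
  rw [e2, ← mul_assoc] at hlo
  rw [e3, abs_le]
  have c1 := mul_le_mul_of_nonneg_left b1 hP
  have c2 := mul_le_mul_of_nonneg_left b2 hP
  constructor <;> linarith

/-- The lattice points `v ∈ ℤ^d` with `|v|² ≤ n`. -/
noncomputable def latticePoints (d n : ℕ) : Finset (Fin d → ℤ) :=
  (Fintype.piFinset fun _ => Finset.Icc (-n : ℤ) n).filter fun v => ∑ i, v i ^ 2 ≤ (n : ℤ)

lemma mem_latticePoints {d n : ℕ} {v : Fin d → ℤ} :
    v ∈ latticePoints d n ↔ ∑ i, v i ^ 2 ≤ (n : ℤ) := by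
  simp only [latticePoints, Finset.mem_filter, Fintype.mem_piFinset, Finset.mem_Icc,
    and_iff_right_iff_imp]
  intro h i
  have h1 := Finset.single_le_sum (f := fun i => v i ^ 2) (fun i _ => sq_nonneg (v i))
    (Finset.mem_univ i)
  have h2 : |v i| ≤ v i ^ 2 := by rw [← sq_abs]; exact Int.le_self_sq _
  exact abs_le.1 (h2.trans (h1.trans h))

lemma card_latticePoints {d : ℕ} {j : ℕ → ℕ}
    (hj : ∀ k : ℕ, j k = Nat.card {v : Fin d → ℤ // ∑ i, (v i) ^ 2 = (k : ℤ)}) (n : ℕ) :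
    (latticePoints d n).card = ∑ k ∈ Finset.range (n + 1), j k := by
  have hnn : ∀ v : Fin d → ℤ, 0 ≤ ∑ i, v i ^ 2 := fun v =>
    Finset.sum_nonneg fun i _ => sq_nonneg (v i)
  rw [Finset.card_eq_sum_card_fiberwise (f := fun v => (∑ i, v i ^ 2).toNat)
    (t := Finset.range (n + 1))]
  · refine Finset.sum_congr rfl fun k hk => ?_
    rw [Finset.mem_range] at hk
    rw [hj]
    refine (Nat.subtype_card _ fun v => ?_).symm
    have := hnn v
    simp only [Finset.mem_filter, mem_latticePoints]
    omega
  · intro v hv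
    have := mem_latticePoints.1 hv
    simp only [Finset.coe_range, Set.mem_Iio]
    omega

/-- The number of lattice points of `ℤ^d` in the closed ball of radius `√u`. -/
noncomputable def latticeCount (d : ℕ) (u : ℝ) : ℝ := (latticePoints d ⌊u⌋₊).card

lemma latticeCount_mono (d : ℕ) : Monotone (latticeCount d) := by
  intro u v huv
  unfold latticeCount
  gcongr
  intro w hw
  rw [mem_latticePoints] at hw ⊢
  exact hw.trans (by exact_mod_cast Nat.floor_mono huv)

lemma abs_latticeCount_sub_le {d : ℕ} (hd : 1 ≤ d) {u : ℝ} (hu : (d : ℝ) ≤ u) :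
    |latticeCount d u - ballVolume d * u ^ ((d : ℝ) / 2)|
      ≤ ballVolume d * 2 ^ d * √d * u ^ ((d : ℝ) / 2) / √u := by
  have hu0 : 0 ≤ u := (Nat.cast_nonneg d).trans hu
  have h : √u ^ d = u ^ ((d : ℝ) / 2) := by
    rw [Real.sqrt_eq_rpow, ← Real.rpow_natCast, ← Real.rpow_mul hu0]
    congr 1
    ring
  rw [← h]
  refine abs_card_sub_ballVolume_mul_le hd (Real.sqrt_le_sqrt hu) _ fun v => ?_
  have hnn : 0 ≤ ∑ i, v i ^ 2 := Finset.sum_nonneg fun i _ => sq_nonneg (v i)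
  obtain ⟨m, hm⟩ := Int.eq_ofNat_of_zero_le hnn
  have hm' : ∑ i, (v i : ℝ) ^ 2 = m := by exact_mod_cast hm
  rw [mem_latticePoints, Real.sq_sqrt hu0, hm, hm', Nat.cast_le, Nat.le_floor_iff hu0]

lemma tsum_ite_eq_latticeCount_sub {d : ℕ} {j : ℕ → ℕ}
    (hj : ∀ k : ℕ, j k = Nat.card {v : Fin d → ℤ // ∑ i, (v i) ^ 2 = (k : ℤ)})
    {y u : ℝ} (hy : 0 ≤ y) (hyu : y ≤ u) :
    ∑' k : ℕ, (if y < k ∧ (k : ℝ) ≤ u then (j k : ℝ) else 0)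
      = latticeCount d u - latticeCount d y := by
  have hu := hy.trans hyu
  rw [tsum_eq_sum (s := Finset.Ico (⌊y⌋₊ + 1) (⌊u⌋₊ + 1))]
  · unfold latticeCount
    rw [card_latticePoints hj, card_latticePoints hj, Nat.cast_sum, Nat.cast_sum,
      ← Finset.sum_Ico_eq_sub _ (Nat.succ_le_succ (Nat.floor_mono hyu))]
    refine Finset.sum_congr rfl fun k hk => if_pos ?_
    rw [Finset.mem_Ico] at hk
    exact ⟨(Nat.floor_lt hy).1 (by omega), (Nat.le_floor_iff hu).1 (by omega)⟩
  · intro k hk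
    refine if_neg fun h => hk ?_
    rw [← Nat.floor_lt hy, ← Nat.le_floor_iff hu] at h
    rw [Finset.mem_Ico]
    omega

lemma count_le_ballVolume_mul_pow {d : ℕ} (hd : 1 ≤ d) {j : ℕ → ℕ}
    (hj : ∀ k : ℕ, j k = Nat.card {v : Fin d → ℤ // ∑ i, (v i) ^ 2 = (k : ℤ)}) (k : ℕ) :
    (j k : ℝ) ≤ ballVolume d * (√k + √d) ^ d := by
  have h := card_le_ballVolume_mul hd (Real.sqrt_nonneg k) (latticePoints d k) fun v => by
    rw [mem_latticePoints, Real.sq_sqrt (Nat.cast_nonneg k)]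
    exact_mod_cast Iff.rfl
  refine le_trans ?_ h
  rw [card_latticePoints hj]
  exact_mod_cast Finset.single_le_sum (f := j) (fun i _ => Nat.zero_le _)
    (Finset.self_mem_range_succ k)

lemma summable_count_mul_pow {d : ℕ} (hd : 1 ≤ d) {j : ℕ → ℕ}
    (hj : ∀ k : ℕ, j k = Nat.card {v : Fin d → ℤ // ∑ i, (v i) ^ 2 = (k : ℤ)})
    {x : ℝ} (hx0 : 0 ≤ x) (hx1 : x < 1) : Summable fun k => (j k : ℝ) * x ^ k := by
  have hs : Summable fun k : ℕ => ballVolume d * (1 + √d) ^ d * ((k : ℝ) ^ d * x ^ k) :=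
    have hx : ‖x‖ < 1 := by rwa [Real.norm_of_nonneg hx0]
    (summable_pow_mul_geometric_of_norm_lt_one (R := ℝ) d hx).mul_left _
  refine hs.of_norm_bounded_eventually_nat ?_
  filter_upwards [eventually_ge_atTop 1] with k hk
  have hk' : (1 : ℝ) ≤ k := by exact_mod_cast hk
  have hV := ballVolume_pos d
  rw [Real.norm_of_nonneg (by positivity), ← mul_assoc]
  gcongr
  refine (count_le_ballVolume_mul_pow hd hj k).trans ?_
  rw [mul_assoc, ← mul_pow]
  gcongr
  have h1 : √(k : ℝ) ≤ k := by
    rw [Real.sqrt_le_left (by positivity)]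
    nlinarith
  have h2 := mul_le_mul_of_nonneg_left hk' (Real.sqrt_nonneg d)
  nlinarith

/-- A tail of a power series with nonnegative coefficients as an exponential integral of its
counting function. -/
lemma tsum_tail_eq_integral {d : ℕ} (hd : 1 ≤ d) {j : ℕ → ℕ}
    (hj : ∀ k : ℕ, j k = Nat.card {v : Fin d → ℤ // ∑ i, (v i) ^ 2 = (k : ℤ)})
    {s a : ℝ} (hs : 0 < s) (ha : 0 ≤ a) :
    ∑' k : ℕ, (if a / s < k then (j k : ℝ) * Real.exp (-s) ^ k else 0)
      = Real.exp (-a) * ∫ w in Set.Ioi 0,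
          (latticeCount d ((a + w) / s) - latticeCount d (a / s)) * Real.exp (-w) := by
  set c : ℕ → ℝ := fun k => if a / s < k then (j k : ℝ) else 0 with hc
  have hc0 : ∀ k, 0 ≤ c k := fun k => by simp only [hc]; split_ifs <;> positivity
  set F : ℕ → ℝ → ℝ := fun k =>
    (Set.Ici (s * k - a)).indicator fun w => c k * Real.exp (-w) with hF
  have hint : ∀ k, IntegrableOn (F k) (Set.Ioi 0) := fun k =>
    ((integrableOn_exp_neg_Ioi 0).const_mul (c k)).indicator measurableSet_Ici
  have hval : ∀ k, ∫ w in Set.Ioi 0, F k w = Real.exp a * (c k * Real.exp (-s) ^ k) := by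
    intro k
    by_cases hk : a / s < k
    · have hb : 0 < s * k - a := by
        rw [div_lt_iff₀ hs] at hk
        linarith
      have hsub : Set.Ioi 0 ∩ Set.Ici (s * k - a) = Set.Ici (s * k - a) :=
        Set.inter_eq_right.2 fun w hw => hb.trans_le hw
      rw [hF, setIntegral_indicator measurableSet_Ici, hsub, integral_Ici_eq_integral_Ioi,
        integral_const_mul, integral_exp_neg_Ioi, ← Real.exp_nat_mul]
      rw [mul_left_comm, ← Real.exp_add]
      congr 2
      ring
    · simp [hF, hc, hk]
  have hFnn : ∀ k w, 0 ≤ F k w := fun k w =>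
    Set.indicator_nonneg (fun w _ => mul_nonneg (hc0 k) (Real.exp_pos _).le) w
  have hsum : Summable fun k => c k * Real.exp (-s) ^ k := by
    refine (summable_count_mul_pow hd hj (Real.exp_pos (-s)).le
      (by simpa using hs)).of_nonneg_of_le
      (fun k => mul_nonneg (hc0 k) (by positivity)) fun k => ?_
    gcongr
    simp only [hc]
    split_ifs <;> simp
  have key := hasSum_integral_of_summable_integral_norm hint (by
    simp only [Real.norm_of_nonneg (hFnn _ _), hval]
    exact hsum.mul_left _)
  simp only [hval] at key
  have hpt : ∀ w ∈ Set.Ioi (0 : ℝ), ∑' k, F k w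
      = (latticeCount d ((a + w) / s) - latticeCount d (a / s)) * Real.exp (-w) := by
    intro w hw
    have hw' : (0 : ℝ) < w := hw
    rw [← tsum_ite_eq_latticeCount_sub hj (by positivity)
      (div_le_div_of_nonneg_right (by linarith) hs.le), ← tsum_mul_right]
    refine tsum_congr fun k => ?_
    have hiff : s * k - a ≤ w ↔ (k : ℝ) ≤ (a + w) / s := by
      rw [le_div_iff₀ hs]
      constructor <;> intro h <;> linarith
    simp only [hF, hc, Set.indicator_apply, Set.mem_Ici, hiff]
    by_cases h1 : a / s < k <;> by_cases h2 : (k : ℝ) ≤ (a + w) / s <;> simp [h1, h2]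
  rw [setIntegral_congr_fun measurableSet_Ioi hpt] at key
  rw [← key.tsum_eq, tsum_mul_left, ← mul_assoc, ← Real.exp_add, neg_add_cancel, Real.exp_zero,
    one_mul]
  refine tsum_congr fun k => ?_
  simp only [hc, ite_mul, zero_mul]

lemma tendsto_mul_one_add_div_rpow_sub_one (p w : ℝ) :
    Tendsto (fun a : ℝ => a * ((1 + w / a) ^ p - 1)) atTop (𝓝 (p * w)) := by
  rcases eq_or_ne w 0 with rfl | hw
  · simp
  have hder : HasDerivAt (fun z : ℝ => (1 + z) ^ p) p 0 := by
    have h := ((hasDerivAt_id (0 : ℝ)).const_add 1).rpow_const (p := p) (Or.inl (by simp))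
    simpa using h
  have hz : Tendsto (fun a : ℝ => w / a) atTop (𝓝[≠] 0) := by
    refine tendsto_nhdsWithin_iff.2 ⟨tendsto_const_nhds.div_atTop tendsto_id, ?_⟩
    filter_upwards [eventually_ne_atTop 0] with a ha
    exact div_ne_zero hw ha
  refine (((hasDerivAt_iff_tendsto_slope.1 hder).comp hz).mul_const w).congr' ?_
  filter_upwards [eventually_ne_atTop 0] with a ha
  simp only [Function.comp_apply, slope_def_field, add_zero, Real.one_rpow, sub_zero]
  field_simp

lemma one_add_rpow_sub_one_le {p z : ℝ} (hp : 0 ≤ p) (hz : 0 ≤ z) :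
    (1 + z) ^ p - 1 ≤ p * z * (1 + z) ^ p := by
  have h1 : (1 + z) ^ p ≤ Real.exp (p * z) := by
    rw [mul_comm, Real.exp_mul]
    exact Real.rpow_le_rpow (by linarith) (by linarith [Real.add_one_le_exp z]) hp
  have h2 : 1 - p * z ≤ Real.exp (-(p * z)) := by linarith [Real.add_one_le_exp (-(p * z))]
  have h3 : (1 + z) ^ p * (1 - p * z) ≤ 1 := by
    calc (1 + z) ^ p * (1 - p * z) ≤ (1 + z) ^ p * Real.exp (-(p * z)) := by gcongr
      _ ≤ Real.exp (p * z) * Real.exp (-(p * z)) := by gcongr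
      _ = 1 := by rw [← Real.exp_add, add_neg_cancel, Real.exp_zero]
  linarith

lemma abs_rescaled_count_sub_le {N : ℝ → ℝ} {V p K u₀ s a w : ℝ} (hp : 0 ≤ p) (hK : 0 ≤ K)
    (hN : ∀ u, u₀ ≤ u → |N u - V * u ^ p| ≤ K * u ^ p / √u)
    (hs : 0 < s) (ha : 1 ≤ a) (hw : 0 ≤ w) (hu : u₀ ≤ a / s) :
    |a ^ (1 - p) * s ^ p * N ((a + w) / s) - V * a * (1 + w / a) ^ p|
      ≤ K * (√s * a) * (1 + w) ^ p := by
  have ha0 : 0 < a := by linarith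
  set u := (a + w) / s with hudef
  have hu0 : 0 < u := by positivity
  have hu1 : u₀ ≤ u := hu.trans (by rw [hudef]; gcongr; linarith)
  have hfac : 0 ≤ a ^ (1 - p) * s ^ p := by positivity
  have hmain : a ^ (1 - p) * s ^ p * u ^ p = a * (1 + w / a) ^ p := by
    have e1 : u = a * (1 + w / a) / s := by rw [hudef]; field_simp
    rw [e1, Real.div_rpow (by positivity) hs.le, Real.mul_rpow ha0.le (by positivity)]
    have e2 : a ^ (1 - p) * a ^ p = a := by
      rw [← Real.rpow_add ha0, sub_add_cancel, Real.rpow_one]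
    have e3 : s ^ p ≠ 0 := (Real.rpow_pos_of_pos hs p).ne'
    calc _ = a ^ (1 - p) * a ^ p * (1 + w / a) ^ p := by field_simp
      _ = _ := by rw [e2]
  have hsqrt : 1 / √u ≤ √s := by
    rw [div_le_iff₀ (Real.sqrt_pos.2 hu0), ← Real.sqrt_mul hs.le, Real.one_le_sqrt, hudef,
      mul_div_cancel₀ _ hs.ne']
    linarith
  calc |a ^ (1 - p) * s ^ p * N u - V * a * (1 + w / a) ^ p|
      = a ^ (1 - p) * s ^ p * |N u - V * u ^ p| := by
        rw [← abs_of_nonneg hfac, ← abs_mul, abs_of_nonneg hfac]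
        congr 1
        rw [mul_sub, mul_assoc V, ← hmain]
        ring
    _ ≤ a ^ (1 - p) * s ^ p * (K * u ^ p / √u) := by gcongr; exact hN u hu1
    _ = K * (a * (1 + w / a) ^ p) * (1 / √u) := by rw [← hmain]; ring
    _ ≤ K * (a * (1 + w) ^ p) * √s := by
        gcongr
        exact div_le_self hw ha
    _ = _ := by ring

lemma abs_rescaled_count_diff_sub_le {N : ℝ → ℝ} {V p K u₀ s a w : ℝ} (hp : 0 ≤ p) (hK : 0 ≤ K)
    (hN : ∀ u, u₀ ≤ u → |N u - V * u ^ p| ≤ K * u ^ p / √u)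
    (hs : 0 < s) (ha : 1 ≤ a) (hw : 0 ≤ w) (hu : u₀ ≤ a / s) :
    |a ^ (1 - p) * s ^ p * (N ((a + w) / s) - N (a / s)) - V * (a * ((1 + w / a) ^ p - 1))|
      ≤ 2 * K * (√s * a) * (1 + w) ^ p := by
  have h1 := abs_rescaled_count_sub_le hp hK hN hs ha hw hu
  have h2 := abs_rescaled_count_sub_le hp hK hN hs ha le_rfl hu
  simp only [add_zero, zero_div, Real.one_rpow, mul_one] at h2
  have h3 : K * (√s * a) ≤ K * (√s * a) * (1 + w) ^ p :=
    le_mul_of_one_le_right (by positivity) (Real.one_le_rpow (by linarith) hp)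
  rw [abs_le] at h1 h2 ⊢
  constructor <;> linarith

lemma integrableOn_one_add_rpow_mul_exp_neg {q : ℝ} (hq : 0 ≤ q) :
    IntegrableOn (fun w : ℝ => (1 + w) ^ q * Real.exp (-w)) (Set.Ioi 0) := by
  refine integrable_of_isBigO_exp_neg (b := 1 / 2) (by norm_num) ?_ ?_
  · refine ContinuousOn.mul ?_ (by fun_prop)
    refine ContinuousOn.rpow_const (by fun_prop) fun w _ => Or.inr hq
  · have h1 : (fun w : ℝ => (1 + w) ^ q) =O[atTop] fun w : ℝ => Real.exp (1 / 2 * (1 + w)) :=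
      ((isLittleO_rpow_exp_pos_mul_atTop q (by norm_num : (0 : ℝ) < 1 / 2)).comp_tendsto
        (tendsto_atTop_add_const_left _ 1 tendsto_id)).isBigO
    have h2 := h1.mul (Asymptotics.isBigO_refl (fun w : ℝ => Real.exp (-w)) atTop)
    refine h2.trans (Asymptotics.IsBigO.of_bound (Real.exp (1 / 2)) (Eventually.of_forall fun w => ?_))
    rw [← Real.exp_add, Real.norm_of_nonneg (Real.exp_pos _).le,
      Real.norm_of_nonneg (Real.exp_pos _).le, ← Real.exp_add]
    exact (congrArg Real.exp (by ring)).le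

lemma integral_mul_exp_neg_Ioi : ∫ w in Set.Ioi (0 : ℝ), w * Real.exp (-w) = 1 := by
  have h := Real.Gamma_eq_integral (s := 2) (by norm_num)
  rw [Real.Gamma_two] at h
  rw [h]
  refine setIntegral_congr_fun measurableSet_Ioi fun w _ => ?_
  norm_num [mul_comm]

/-- Local increments of a monotone function with `N u = V u ^ p + O(u ^ (p - 1 / 2))`, averaged
against the exponential law at scale `1 / s` beyond `a / s`. -/
lemma tendsto_integral_rescaled_count {ι : Type*} {l : Filter ι} [l.IsCountablyGenerated]
    {N : ℝ → ℝ} (hmono : Monotone N) {V p K u₀ : ℝ} (hV : 0 ≤ V) (hp : 0 ≤ p) (hK : 0 ≤ K)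
    (hN : ∀ u, u₀ ≤ u → |N u - V * u ^ p| ≤ K * u ^ p / √u)
    {s a : ι → ℝ} (hs0 : ∀ᶠ i in l, 0 < s i) (hs : Tendsto s l (𝓝 0)) (ha : Tendsto a l atTop)
    (hsa : Tendsto (fun i => √(s i) * a i) l (𝓝 0)) :
    Tendsto (fun i => a i ^ (1 - p) * s i ^ p * ∫ w in Set.Ioi 0,
      (N ((a i + w) / s i) - N (a i / s i)) * Real.exp (-w)) l (𝓝 (V * p)) := by
  have hev : ∀ᶠ i in l, 0 < s i ∧ 1 ≤ a i ∧ u₀ ≤ a i / s i ∧ √(s i) * a i ≤ 1 := by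
    filter_upwards [hs0, hs.eventually (gt_mem_nhds one_pos), ha.eventually_ge_atTop 1,
      ha.eventually_ge_atTop u₀, hsa.eventually (gt_mem_nhds one_pos)] with i h1 h2 h3 h4 h5
    refine ⟨h1, h3, h4.trans ?_, h5.le⟩
    rw [le_div_iff₀ h1]
    nlinarith
  have hlim : ∫ w in Set.Ioi (0 : ℝ), V * (p * w) * Real.exp (-w) = V * p := by
    rw [← mul_one (V * p), ← integral_mul_exp_neg_Ioi, ← integral_const_mul]
    congr 1
    ext w
    ring
  rw [← hlim]
  simp only [← integral_const_mul]
  refine tendsto_integral_filter_of_dominated_convergence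
    (fun w => (V * p + 2 * K) * ((1 + w) ^ (p + 1) * Real.exp (-w))) ?_ ?_ ?_ ?_
  · filter_upwards [hev] with i hi
    have hm : Measurable fun w => N ((a i + w) / s i) :=
      hmono.measurable.comp (by fun_prop)
    exact (((hm.sub_const _).mul (by fun_prop)).const_mul _).aestronglyMeasurable
  · filter_upwards [hev] with i ⟨hsi, hai, hui, hsai⟩
    filter_upwards [ae_restrict_mem measurableSet_Ioi] with w hw
    have hw0 : (0 : ℝ) < w := hw
    have h1 := abs_rescaled_count_diff_sub_le hp hK hN hsi hai hw0.le hui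
    have hai0 : 0 < a i := by linarith
    have hz : 0 ≤ w / a i := by positivity
    have h2 := one_add_rpow_sub_one_le hp hz
    have h3 : 1 ≤ (1 + w / a i) ^ p := Real.one_le_rpow (by linarith) hp
    have hwa : w / a i ≤ w := div_le_self hw0.le hai
    have h4 : a i * ((1 + w / a i) ^ p - 1) ≤ p * w * (1 + w) ^ p := by
      calc a i * ((1 + w / a i) ^ p - 1) ≤ a i * (p * (w / a i) * (1 + w / a i) ^ p) := by gcongr
        _ = p * w * (1 + w / a i) ^ p := by field_simp
        _ ≤ p * w * (1 + w) ^ p := by gcongr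
    have hR : (1 + w) ^ (p + 1) = (1 + w) ^ p * (1 + w) := by
      rw [Real.rpow_add (by linarith), Real.rpow_one]
    rw [← mul_assoc, ← mul_assoc, norm_mul, Real.norm_of_nonneg (Real.exp_pos _).le]
    gcongr
    rw [Real.norm_eq_abs]
    have h5 : |V * (a i * ((1 + w / a i) ^ p - 1))| ≤ V * (p * w * (1 + w) ^ p) := by
      rw [abs_of_nonneg (mul_nonneg hV (mul_nonneg hai0.le (by linarith)))]
      gcongr
    have h6 : 2 * K * (√(s i) * a i) * (1 + w) ^ p ≤ 2 * K * 1 * (1 + w) ^ p := by gcongr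
    have h7 := abs_sub_abs_le_abs_sub
      (a i ^ (1 - p) * s i ^ p * (N ((a i + w) / s i) - N (a i / s i)))
      (V * (a i * ((1 + w / a i) ^ p - 1)))
    have h8 : 0 ≤ K * (1 + w) ^ p * w := by positivity
    have h9 : 0 ≤ V * p * (1 + w) ^ p := by positivity
    rw [hR]
    linarith
  · exact (integrableOn_one_add_rpow_mul_exp_neg (by linarith)).const_mul _
  · filter_upwards [ae_restrict_mem measurableSet_Ioi] with w hw
    have hw0 : (0 : ℝ) < w := hw
    simp only [← mul_assoc]
    refine Tendsto.mul_const _ ?_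
    rw [mul_assoc V]
    have h1 : Tendsto (fun i => V * (a i * ((1 + w / a i) ^ p - 1))) l (𝓝 (V * (p * w))) :=
      ((tendsto_mul_one_add_div_rpow_sub_one p w).comp ha).const_mul V
    have h2 : Tendsto (fun i => a i ^ (1 - p) * s i ^ p *
        (N ((a i + w) / s i) - N (a i / s i)) - V * (a i * ((1 + w / a i) ^ p - 1))) l (𝓝 0) := by
      refine squeeze_zero_norm' (a := fun i => 2 * K * (√(s i) * a i) * (1 + w) ^ p) ?_ ?_
      · filter_upwards [hev] with i ⟨hsi, hai, hui, _⟩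
        exact abs_rescaled_count_diff_sub_le hp hK hN hsi hai hw0.le hui
      · simpa using (hsa.const_mul (2 * K)).mul_const ((1 + w) ^ p)
    simpa using h2.add h1

lemma tendsto_one_sub_nhdsLT_one : Tendsto (fun x : ℝ => 1 - x) (𝓝[<] 1) (𝓝[>] 0) := by
  refine tendsto_nhdsWithin_iff.2 ⟨?_, ?_⟩
  · have h : Tendsto (fun x : ℝ => 1 - x) (𝓝 1) (𝓝 (1 - 1)) := by
      exact (continuous_const.sub continuous_id).tendsto 1
    rw [sub_self] at h
    exact h.mono_left nhdsWithin_le_nhds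
  · filter_upwards [self_mem_nhdsWithin] with x hx
    exact sub_pos.2 (Set.mem_Iio.1 hx)

lemma tendsto_neg_log_div_one_sub :
    Tendsto (fun x : ℝ => -Real.log x / (1 - x)) (𝓝[<] 1) (𝓝 1) := by
  have h := hasDerivAt_iff_tendsto_slope.1 (Real.hasDerivAt_log one_ne_zero)
  rw [inv_one] at h
  refine (h.mono_left (nhdsWithin_mono _ fun x hx => (Set.mem_Iio.1 hx).ne)).congr fun x => ?_
  rw [slope_def_field, Real.log_one, sub_zero, ← neg_sub x 1, neg_div_neg_eq]

lemma tendsto_abs_log_one_sub : Tendsto (fun x : ℝ => |Real.log (1 - x)|) (𝓝[<] 1) atTop :=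
  tendsto_abs_atBot_atTop.comp (Real.tendsto_log_nhdsGT_zero.comp tendsto_one_sub_nhdsLT_one)

lemma tendsto_sqrt_one_sub_mul_abs_log :
    Tendsto (fun x : ℝ => √(1 - x) * |Real.log (1 - x)|) (𝓝[<] 1) (𝓝 0) := by
  have h := (tendsto_log_mul_rpow_nhdsGT_zero (r := 1 / 2) (by norm_num)).comp
    tendsto_one_sub_nhdsLT_one
  have h' := h.abs
  rw [abs_zero] at h'
  refine h'.congr fun x => ?_
  rw [Function.comp_apply, abs_mul, ← Real.sqrt_eq_rpow, abs_of_nonneg (Real.sqrt_nonneg _),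
    mul_comm]

lemma tendsto_linear_add_log_div_self (p q c : ℝ) :
    Tendsto (fun L : ℝ => (p * L + q * Real.log L + c) / L) atTop (𝓝 p) := by
  have h1 : Tendsto (fun L : ℝ => Real.log L / L) atTop (𝓝 0) :=
    Real.isLittleO_log_id_atTop.tendsto_div_nhds_zero
  have h2 : Tendsto (fun L : ℝ => c / L) atTop (𝓝 0) := tendsto_const_nhds.div_atTop tendsto_id
  have h := ((tendsto_const_nhds (x := p)).add (h1.const_mul q)).add h2
  rw [mul_zero, add_zero, add_zero] at h
  refine h.congr' ?_
  filter_upwards [eventually_ne_atTop 0] with L hL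
  field_simp

/-- The centering makes the rescaling factor asymptotically constant. -/
lemma exp_neg_centering_eq {p V L s a t y : ℝ} (hp : 0 < p) (hV : 0 < V) (hL : 0 < L) (hs : 0 < s)
    (ha : 0 < a) (hy : 0 < y) (hyL : Real.log y = -L)
    (haL : a = p * L + (p - 1) * Real.log L + p * Real.log p + Real.log V + t) :
    Real.exp (-a) = Real.exp (-t) / (p ^ p * V) * (s / y) ^ (-p) * (a / L) ^ (p - 1)
      * (a ^ (1 - p) * s ^ p) := by
  have e : Real.exp (-t) / (p ^ p * V) * (s / y) ^ (-p) * (a / L) ^ (p - 1)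
      * (a ^ (1 - p) * s ^ p) = Real.exp (-t) / (p ^ p * V) * (y ^ p * L ^ (1 - p)) := by
    rw [Real.div_rpow hs.le hy.le, Real.div_rpow ha.le hL.le, Real.rpow_neg hs.le,
      Real.rpow_neg hy.le, ← neg_sub p 1, Real.rpow_neg ha.le, Real.rpow_neg hL.le]
    have h1 := (Real.rpow_pos_of_pos hs p).ne'
    have h2 := (Real.rpow_pos_of_pos hy p).ne'
    have h3 := (Real.rpow_pos_of_pos ha (p - 1)).ne'
    have h4 := (Real.rpow_pos_of_pos hL (p - 1)).ne'
    field_simp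
  rw [e, Real.rpow_def_of_pos hp, Real.rpow_def_of_pos hy, Real.rpow_def_of_pos hL, hyL]
  have hexp : Real.exp (Real.log p * p) * V = Real.exp (Real.log p * p + Real.log V) := by
    rw [Real.exp_add, Real.exp_log hV]
  rw [hexp, ← Real.exp_add, ← Real.exp_sub, ← Real.exp_add, haL]
  congr 1
  ring

/-- **Key step in the proof of Theorem 2.** With `j_d(k)` the number of
representations of `k` as a sum of `d` squares of integers, the centering `A(x)`
of the Bose gas and `M(x,t) = ⌊(A(x)+t)/|log x|⌋`, the tail sum
`∑_{k > M(x,t)} j_d(k) x^k` converges to `e^{-t}` as `x → 1⁻`. -/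
theorem stmt_7 (d : ℕ) (hd : 1 ≤ d)
    (jd : ℕ → ℕ)
    (hjd : ∀ k : ℕ, jd k = Nat.card {v : Fin d → ℤ // ∑ i, (v i) ^ 2 = (k : ℤ)})
    (A : ℝ → ℝ)
    (hA : ∀ x : ℝ, A x = ((d : ℝ) / 2) * |Real.log (1 - x)|
      + (((d : ℝ) - 2) / 2) * Real.log |Real.log (1 - x)|
      + ((d : ℝ) / 2) * Real.log ((d : ℝ) / 2)
      + Real.log (Real.pi ^ ((d : ℝ) / 2) / Real.Gamma ((d : ℝ) / 2 + 1)))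
    (t : ℝ) :
    Tendsto (fun x : ℝ => ∑' k : ℕ,
        if ⌊(A x + t) / |Real.log x|⌋ < (k : ℤ) then (jd k : ℝ) * x ^ k else 0)
      (𝓝[<] (1 : ℝ)) (𝓝 (Real.exp (-t))) := by
  have hp : (0 : ℝ) < (d : ℝ) / 2 := by
    have : (0 : ℝ) < d := by exact_mod_cast hd
    positivity
  have hV := ballVolume_pos d
  set p : ℝ := (d : ℝ) / 2 with hpdef
  set V : ℝ := ballVolume d with hVdef
  have haL : ∀ x, A x + t = p * |Real.log (1 - x)| + (p - 1) * Real.log |Real.log (1 - x)|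
      + p * Real.log p + Real.log V + t := fun x => by
    rw [hA, hVdef, ballVolume, ← hpdef, show ((d : ℝ) - 2) / 2 = p - 1 by rw [hpdef]; ring]
  have hev : ∀ᶠ x : ℝ in 𝓝[<] 1, 0 < x ∧ x < 1 := Ioo_mem_nhdsLT one_pos
  have hratio : Tendsto (fun x => (A x + t) / |Real.log (1 - x)|) (𝓝[<] 1) (𝓝 p) := by
    refine ((tendsto_linear_add_log_div_self p (p - 1) (p * Real.log p + Real.log V + t)).comp
      tendsto_abs_log_one_sub).congr fun x => ?_
    rw [haL, Function.comp_apply]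
    ring
  have hLpos := tendsto_abs_log_one_sub.eventually_gt_atTop 0
  have ha : Tendsto (fun x => A x + t) (𝓝[<] 1) atTop := by
    refine (hratio.pos_mul_atTop hp tendsto_abs_log_one_sub).congr' ?_
    filter_upwards [hLpos] with x hx
    exact div_mul_cancel₀ _ hx.ne'
  have hspos : ∀ᶠ x : ℝ in 𝓝[<] 1, 0 < -Real.log x := by
    filter_upwards [hev] with x hx
    exact neg_pos.2 (Real.log_neg hx.1 hx.2)
  have hs : Tendsto (fun x : ℝ => -Real.log x) (𝓝[<] 1) (𝓝 0) := by
    have h := (Real.continuousAt_log one_ne_zero).neg.tendsto.mono_left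
      (nhdsWithin_le_nhds (s := Set.Iio 1))
    rwa [Pi.neg_apply, Real.log_one, neg_zero] at h
  have hsa : Tendsto (fun x : ℝ => √(-Real.log x) * (A x + t)) (𝓝[<] 1) (𝓝 0) := by
    have h := (tendsto_neg_log_div_one_sub.sqrt.mul hratio).mul tendsto_sqrt_one_sub_mul_abs_log
    rw [mul_zero] at h
    refine h.congr' ?_
    filter_upwards [hev, hLpos] with x hx hL
    have h1 : 0 < 1 - x := sub_pos.2 hx.2
    rw [Real.sqrt_div' _ h1.le]
    have := (Real.sqrt_pos.2 h1).ne'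
    field_simp
  have hint := tendsto_integral_rescaled_count (latticeCount_mono d) hV.le hp.le
    (K := V * 2 ^ d * √d) (by positivity) (fun u hu => abs_latticeCount_sub_le hd hu)
    hspos hs ha hsa
  have hfac := ((tendsto_neg_log_div_one_sub.rpow_const (p := -p) (Or.inl one_ne_zero)).const_mul
    (Real.exp (-t) / (p ^ p * V))).mul (hratio.rpow_const (p := p - 1) (Or.inl hp.ne'))
  have hlim : Real.exp (-t) / (p ^ p * V) * 1 ^ (-p) * p ^ (p - 1) * (V * p) = Real.exp (-t) := by
    rw [Real.one_rpow, Real.rpow_sub_one hp.ne']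
    have := (Real.rpow_pos_of_pos hp p).ne'
    field_simp
  have hmain := hfac.mul hint
  rw [hlim] at hmain
  refine hmain.congr' ?_
  filter_upwards [hev, hLpos, hspos, ha.eventually_gt_atTop 0] with x hx hL hsx hax
  have hx1 : 0 < 1 - x := sub_pos.2 hx.2
  have hlog : |Real.log x| = -Real.log x := abs_of_neg (neg_pos.1 hsx)
  have hlog1 : Real.log (1 - x) = -|Real.log (1 - x)| := by
    rw [abs_of_neg (Real.log_neg hx1 (by linarith [hx.1])), neg_neg]
  have htail := tsum_tail_eq_integral hd hjd hsx hax.le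
  rw [neg_neg, Real.exp_log hx.1] at htail
  simp only [hlog, Int.floor_lt, Int.cast_natCast]
  rw [htail, exp_neg_centering_eq hp hV hL hsx hax hx1 hlog1 (haL x)]
  ring
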